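/- arXiv:1802.02859 — 4 statements merged into one kernel-verified Lean document; each statement's English description precedes it below -/
import Mathlib

section
/- Let Ψ_0 = |↑⟩ + |↓⟩ be the unnormalized initial spin state, and for each n let Ψ_{n+1} be obtained from Ψ_n by applying the combined Raman-scattering-plus-Y_{π/2}-rotation map E to the spin factor, where E is the linear map E|↑⟩ = (|↑⟩ + |↓⟩) ⊗ |1⟩, E|↓⟩ = (|↑⟩ − |↓⟩) ⊗ |0⟩, and appending the newly created photon qubit as the last tensor factor. Then for every n ≥ 1 the joint spin–photon state decomposes as Ψ_n = |↑⟩ ⊗ S_+^(n) + |↓⟩ ⊗ S_-^(n); i.e., conditioned on measuring the spin in |↑⟩ (resp. |↓⟩), the n-photon state is S_+^(n) (resp. S_-^(n)), and these satisfy the recursions S_+^(n) = S_+^(n−1) ⊗ |1⟩ + S_-^(n−1) ⊗ |0⟩ and S_-^(n) = S_+^(n−1) ⊗ |1⟩ − S_-^(n−1) ⊗ |0⟩. -/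
/-- The `n`-qubit photon state space `H_n = (Fin n → Bool) → ℂ`. -/
abbrev H (n : ℕ) := (Fin n → Bool) → ℂ

/-- Computational basis vector `|f⟩`. -/
noncomputable def ket {n : ℕ} (f : Fin n → Bool) : H n := fun g => if g = f then 1 else 0

/-- Single-qubit basis vector: `qubit true = |1⟩` (blue), `qubit false = |0⟩` (red). -/
noncomputable def qubit (b : Bool) : H 1 := ket (fun _ => b)

/-- Tensor product appending a single qubit as the last factor. -/
noncomputable def tensAppend {n : ℕ} (v : H n) (w : H 1) : H (n + 1) :=
  fun f => v (fun i => f i.castSucc) * w (fun _ => f (Fin.last n))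

/-- The protocol states: `S k true = S_+^(k+1)`, `S k false = S_-^(k+1)`. -/
noncomputable def S : (k : ℕ) → Bool → H (k + 1)
  | 0, true => qubit true + qubit false
  | 0, false => qubit true - qubit false
  | k + 1, true =>
      tensAppend (S k true) (qubit true) + tensAppend (S k false) (qubit false)
  | k + 1, false =>
      tensAppend (S k true) (qubit true) - tensAppend (S k false) (qubit false)

/-- Joint spin–photon space `ℂ² ⊗ H_n ≅ (Bool × (Fin n → Bool)) → ℂ`. -/
abbrev J (n : ℕ) := (Bool × (Fin n → Bool)) → ℂ

/-- Tensor product of a spin vector with a photon vector. -/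
noncomputable def spinTens {n : ℕ} (w : Bool → ℂ) (v : H n) : J n := fun p => w p.1 * v p.2

/-- Spin-up basis vector `|↑⟩` (spin `true`). -/
noncomputable def up : Bool → ℂ := fun s => if s then 1 else 0

/-- Spin-down basis vector `|↓⟩` (spin `false`). -/
noncomputable def dn : Bool → ℂ := fun s => if s then 0 else 1

/-- The joint spin–photon state of the protocol: `Ψ_0 = (|↑⟩ + |↓⟩) ⊗ (vacuum)`, and
`Ψ_{n+1}` is obtained from `Ψ_n` by applying to the spin factor the linear map
`E|↑⟩ = (|↑⟩ + |↓⟩) ⊗ |1⟩`, `E|↓⟩ = (|↑⟩ − |↓⟩) ⊗ |0⟩`,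
appending the newly created photon as the last tensor factor. -/
noncomputable def Psi : (n : ℕ) → J n
  | 0 => spinTens (up + dn) (fun _ => 1)
  | n + 1 => fun p =>
      if p.2 (Fin.last n) then Psi n (true, fun i => p.2 i.castSucc)
      else (if p.1 then (1 : ℂ) else -1) * Psi n (false, fun i => p.2 i.castSucc)

/-- For every `n ≥ 1` (here `n = k + 1`), the joint spin–photon state decomposes as
`Ψ_n = |↑⟩ ⊗ S_+^(n) + |↓⟩ ⊗ S_-^(n)`, and the conditional photon states satisfy the
recursions `S_±^(n+1) = S_+^(n) ⊗ |1⟩ ± S_-^(n) ⊗ |0⟩`. -/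
theorem raman_cluster_decomposition :
    ∀ k : ℕ,
      Psi (k + 1) = spinTens up (S k true) + spinTens dn (S k false) ∧
      S (k + 1) true =
        tensAppend (S k true) (qubit true) + tensAppend (S k false) (qubit false) ∧
      S (k + 1) false =
        tensAppend (S k true) (qubit true) - tensAppend (S k false) (qubit false) := by
  intro k
  refine ⟨?_, by simp only [S], by simp only [S]⟩
  have hq : ∀ b c : Bool, qubit b (fun _ => c) = if c = b then 1 else 0 := by
    intro b c
    cases b <;> cases c <;> simp [qubit, ket, funext_iff]
  induction k with
  | zero =>
    funext ⟨s, f⟩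
    obtain ⟨c, rfl⟩ : ∃ c : Bool, f = fun _ => c :=
      ⟨f 0, by funext i; exact congrArg f (Fin.ext (by omega))⟩
    cases s <;> cases c <;> simp [Psi, S, spinTens, up, dn, hq]
  | succ k ih =>
    funext ⟨s, f⟩
    rw [Psi, ih]
    cases s <;> cases hc : f (Fin.last (k + 1)) <;>
      simp [S, spinTens, tensAppend, up, dn, hq, hc]
end

section
/- For every n ≥ 2, the n-photon states S_+^(n) and S_-^(n) satisfy the full set of linear-cluster-state stabilizer eigenvalue equations: for every 1 ≤ a ≤ n, K_n^(a) S_+^(n) = (−1)^{k_+^(a)} S_+^(n) and K_n^(a) S_-^(n) = (−1)^{k_-^(a)} S_-^(n), where k_+^(a) = 1 if a ∈ {1, n} and k_+^(a) = 0 if 1 < a < n, while k_-^(a) = 1 if a = 1 and k_-^(a) = 0 if 1 < a ≤ n. In particular, both S_+^(n) and S_-^(n) are n-qubit linear cluster states (up to local sign conventions). -/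
/-- Pauli-X operator on qubit `a`: `σ_x^(a)|f⟩ = |f with bit a flipped⟩`. -/
noncomputable def sigmaX {n : ℕ} (a : Fin n) (v : H n) : H n :=
  fun f => v (Function.update f a (!(f a)))

/-- Product of Pauli-Z operators over a set `s` of qubits:
`(∏_{b ∈ s} σ_z^(b))|f⟩ = (∏_{b ∈ s} (−1)^{f_b})|f⟩`. -/
noncomputable def zProd {n : ℕ} (s : Finset (Fin n)) (v : H n) : H n :=
  fun f => (∏ b ∈ s, (if f b then (-1 : ℂ) else 1)) * v f

/-- The set of nearest neighbours of site `a` on the line `{0, …, n−1}` (0-indexed). -/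
def neighbours {n : ℕ} (a : Fin n) : Finset (Fin n) :=
  Finset.univ.filter (fun b : Fin n => (b : ℕ) + 1 = (a : ℕ) ∨ (a : ℕ) + 1 = (b : ℕ))

/-- Linear-cluster stabilizer `K_n^(a) = σ_x^(a) ∏_{b ∈ N(a)} σ_z^(b)`. -/
noncomputable def Kstab {n : ℕ} (a : Fin n) (v : H n) : H n :=
  sigmaX a (zProd (neighbours a) v)

/-- The sign `(-1)^b`. -/
noncomputable def zsgn (b : Bool) : ℂ := if b then (-1 : ℂ) else 1

/-- The product of the signs of the neighbours of `a`. -/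
noncomputable def nbProd {n : ℕ} (a : Fin n) (f : Fin n → Bool) : ℂ :=
  ∏ b : Fin n, if ((b : ℕ) + 1 = (a : ℕ) ∨ (a : ℕ) + 1 = (b : ℕ)) then zsgn (f b) else 1

theorem Kstab_apply {n : ℕ} (a : Fin n) (v : H n) (f : Fin n → Bool) :
    Kstab a v f = nbProd a f * v (Function.update f a (!(f a))) := by
  unfold Kstab sigmaX zProd neighbours nbProd
  congr 1
  rw [Finset.prod_filter]
  refine Finset.prod_congr rfl fun b _ => ?_
  by_cases hb : b = a
  · subst hb
    simp
  · simp [Function.update_of_ne hb, zsgn]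

theorem qubit_apply (b c : Bool) : qubit b (fun _ => c) = if c = b then 1 else 0 := by
  cases b <;> cases c <;> simp [qubit, ket, funext_iff]

theorem S_zero (s : Bool) (f : Fin 1 → Bool) :
    S 0 s f = if !s && !(f 0) then -1 else 1 := by
  have hf : f = fun _ => f 0 := by
    funext i
    rw [Subsingleton.elim i 0]
  rw [hf]
  cases s <;> cases f 0 <;> simp [S, qubit_apply]

theorem S_succ (k : ℕ) (s : Bool) (f : Fin (k + 2) → Bool) :
    S (k + 1) s f = (if !s && !(f (Fin.last (k + 1))) then -1 else 1) *
      S k (f (Fin.last (k + 1))) (fun i => f i.castSucc) := by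
  cases s <;> cases h : f (Fin.last (k + 1)) <;> simp [S, tensAppend, qubit_apply, h]

theorem S_false (k : ℕ) (f : Fin (k + 1) → Bool) :
    S k false f = -zsgn (f (Fin.last k)) * S k true f := by
  cases k with
  | zero => cases h : f 0 <;> simp [S_zero, zsgn, h]
  | succ k => cases h : f (Fin.last (k + 1)) <;> simp [S_succ, zsgn, h]

theorem nbProd_castSucc (k : ℕ) (a : Fin (k + 1)) (f : Fin (k + 2) → Bool) :
    nbProd a.castSucc f = nbProd a (fun i => f i.castSucc) *
      (if a = Fin.last k then zsgn (f (Fin.last (k + 1))) else 1) := by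
  unfold nbProd
  rw [Fin.prod_univ_castSucc]
  congr 1
  have h : (((Fin.last (k + 1) : Fin (k + 2)) : ℕ) + 1 = (a.castSucc : ℕ) ∨
      (a.castSucc : ℕ) + 1 = ((Fin.last (k + 1) : Fin (k + 2)) : ℕ)) ↔ a = Fin.last k := by
    rw [Fin.ext_iff]
    have := a.isLt
    simp only [Fin.val_last, Fin.val_castSucc]
    omega
  simp only [h]

theorem nbProd_last (k : ℕ) (f : Fin (k + 2) → Bool) :
    nbProd (Fin.last (k + 1)) f = zsgn (f (Fin.last k).castSucc) := by
  unfold nbProd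
  rw [Finset.prod_eq_single (Fin.last k).castSucc]
  · simp
  · intro b _ hb
    rw [if_neg]
    have := b.isLt
    rw [Ne, Fin.ext_iff] at hb
    simp only [Fin.val_last, Fin.val_castSucc] at hb ⊢
    omega
  · simp

theorem main_aux (k : ℕ) : ∀ (a : Fin (k + 1)) (s : Bool) (f : Fin (k + 1) → Bool),
    nbProd a f * S k s (Function.update f a (!(f a))) =
      (if a = 0 then -1 else 1) * (if s ∧ a = Fin.last k then -1 else 1) * S k s f := by
  induction k with
  | zero =>
    intro a s f
    obtain rfl : a = 0 := Fin.ext (by omega)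
    cases s <;> cases h : f 0 <;> simp [S_zero, nbProd, h]
  | succ k ih =>
    intro a s f
    induction a using Fin.lastCases with
    | last =>
      have h1 : (fun i : Fin (k + 1) => Function.update f (Fin.last (k + 1))
          (!(f (Fin.last (k + 1)))) i.castSucc) = fun i => f i.castSucc := by
        funext i
        rw [Function.update_of_ne (Fin.castSucc_lt_last i).ne]
      rw [nbProd_last, S_succ, S_succ, h1, Function.update_self]
      have h2 := S_false k (fun i => f i.castSucc)
      have h3 : Fin.last (k + 1) ≠ 0 := (Fin.last_pos).ne'
      cases s <;> cases h : f (Fin.last (k + 1)) <;>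
        cases h' : f (Fin.last k).castSucc <;> simp [h2, h', h3, zsgn]
    | cast a =>
      have h1 : (fun i : Fin (k + 1) => Function.update f a.castSucc
          (!(f a.castSucc)) i.castSucc) =
          Function.update (fun i : Fin (k + 1) => f i.castSucc) a (!(f a.castSucc)) := by
        funext i
        by_cases hi : i = a
        · subst hi
          simp
        · rw [Function.update_of_ne hi, Function.update_of_ne]
          exact fun h => hi (Fin.castSucc_injective _ h)
      have h0 : (Fin.last (k + 1)) ≠ a.castSucc := (Fin.castSucc_lt_last a).ne'
      have hz : a.castSucc = 0 ↔ a = 0 := Fin.castSucc_eq_zero_iff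
      rw [nbProd_castSucc, S_succ, S_succ, h1, Function.update_of_ne h0]
      have h2 := ih a (f (Fin.last (k + 1))) (fun i => f i.castSucc)
      simp only [hz, h0.symm, and_false, if_false]
      rw [mul_mul_mul_comm, mul_comm (nbProd _ _), mul_mul_mul_comm]
      generalize S k (f (Fin.last (k + 1))) (Function.update (fun i : Fin (k + 1) =>
        f i.castSucc) a (!(f a.castSucc))) = X at h2 ⊢
      generalize S k (f (Fin.last (k + 1))) (fun i : Fin (k + 1) => f i.castSucc) = Y at h2 ⊢
      generalize nbProd a (fun i : Fin (k + 1) => f i.castSucc) = P at h2 ⊢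
      by_cases hl : a = Fin.last k <;> cases h : f (Fin.last (k + 1)) <;>
        simp only [hl, h, zsgn] at h2 ⊢ <;> simp at h2 ⊢ <;> grind

/-- For every `n ≥ 2` (here `n = k + 1` with `k ≥ 1`), the protocol states satisfy the
full set of linear-cluster stabilizer eigenvalue equations
`K_n^(a) S_±^(n) = (−1)^{k_±^(a)} S_±^(n)`, where (in 1-indexed site labels `1 ≤ a ≤ n`)
`k_+^(a) = 1` iff `a ∈ {1, n}` and `k_-^(a) = 1` iff `a = 1` (both `0` otherwise);
here sites are 0-indexed so site `1` is `a = 0` and site `n` is `a = Fin.last k`. -/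
theorem protocol_states_are_linear_cluster_states :
    ∀ k : ℕ, 1 ≤ k → ∀ a : Fin (k + 1),
      Kstab a (S k true) =
        (if a = 0 ∨ a = Fin.last k then (-1 : ℂ) else 1) • S k true ∧
      Kstab a (S k false) =
        (if a = 0 then (-1 : ℂ) else 1) • S k false := by
  intro k hk a
  have h3 : (0 : Fin (k + 1)) ≠ Fin.last k := by
    rw [Ne, Fin.ext_iff]
    simp
    omega
  constructor
  · funext f
    rw [Kstab_apply, main_aux, Pi.smul_apply, smul_eq_mul]
    by_cases h : a = 0
    · subst h
      simp [h3]
    · simp [h]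
  · funext f
    rw [Kstab_apply, main_aux, Pi.smul_apply, smul_eq_mul]
    simp
end

section
/- Let χ_1, …, χ_n ∈ ℝ be the random spin-precession phases accumulated around each scattering event, and define the phase-dressed protocol states by the recursion S̃_+^(1) = e^{−iχ_1/2}|1⟩ + e^{iχ_1/2}|0⟩, S̃_-^(1) = e^{−iχ_1/2}|1⟩ − e^{iχ_1/2}|0⟩, and S̃_±^(k+1) = e^{−iχ_{k+1}/2} S̃_+^(k) ⊗ |1⟩ ± e^{iχ_{k+1}/2} S̃_-^(k) ⊗ |0⟩. Then for every n ≥ 1 and σ ∈ {+, −}, S̃_σ^(n) = (D(χ_1) ⊗ ⋯ ⊗ D(χ_n)) S_σ^(n), where D(χ) is the single-qubit diagonal unitary D(χ)|1⟩ = e^{−iχ/2}|1⟩, D(χ)|0⟩ = e^{iχ/2}|0⟩. In particular, the phase-dressed state is local-unitarily equivalent to the linear cluster state S_σ^(n). -/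
/-- The phase-dressed protocol states `S̃_±^(k+1)`, for precession phases
`χ 0, χ 1, …` (so `χ_(j+1)` of the paper is `χ j`):
`S̃_±^(1) = e^{−iχ_1/2}|1⟩ ± e^{iχ_1/2}|0⟩` and
`S̃_±^(k+1) = e^{−iχ_{k+1}/2} S̃_+^(k) ⊗ |1⟩ ± e^{iχ_{k+1}/2} S̃_-^(k) ⊗ |0⟩`. -/
noncomputable def St (χ : ℕ → ℝ) : (k : ℕ) → Bool → H (k + 1)
  | 0, true =>
      Complex.exp (-(Complex.I * (χ 0) / 2)) • qubit true +
        Complex.exp (Complex.I * (χ 0) / 2) • qubit false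
  | 0, false =>
      Complex.exp (-(Complex.I * (χ 0) / 2)) • qubit true -
        Complex.exp (Complex.I * (χ 0) / 2) • qubit false
  | k + 1, true =>
      Complex.exp (-(Complex.I * (χ (k + 1)) / 2)) • tensAppend (St χ k true) (qubit true) +
        Complex.exp (Complex.I * (χ (k + 1)) / 2) • tensAppend (St χ k false) (qubit false)
  | k + 1, false =>
      Complex.exp (-(Complex.I * (χ (k + 1)) / 2)) • tensAppend (St χ k true) (qubit true) -
        Complex.exp (Complex.I * (χ (k + 1)) / 2) • tensAppend (St χ k false) (qubit false)

/-- The local (single-qubit) diagonal unitary `D(χ_1) ⊗ ⋯ ⊗ D(χ_n)` acting on `H_n`,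
where `D(χ)|1⟩ = e^{−iχ/2}|1⟩` and `D(χ)|0⟩ = e^{iχ/2}|0⟩`. -/
noncomputable def Dloc (χ : ℕ → ℝ) {n : ℕ} (v : H n) : H n :=
  fun f =>
    (∏ i : Fin n, Complex.exp ((if f i then (-1 : ℂ) else 1) * Complex.I * (χ (i : ℕ)) / 2)) *
      v f

/-- For every `n ≥ 1` (here `n = k + 1`) and each sign `σ` (`true = +`, `false = −`),
the phase-dressed protocol state equals the local unitary `D(χ_1) ⊗ ⋯ ⊗ D(χ_n)` applied
to the undressed linear cluster state: `S̃_σ^(n) = (D(χ_1) ⊗ ⋯ ⊗ D(χ_n)) S_σ^(n)`. -/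
theorem dressed_state_is_local_unitary_of_cluster :
    ∀ (χ : ℕ → ℝ) (k : ℕ) (σ : Bool), St χ k σ = Dloc χ (S k σ) := by
  have hq : ∀ (b c : Bool), qubit b (fun _ => c) = if c = b then 1 else 0 := by
    intro b c
    simp [qubit, ket, funext_iff]
  intro χ k
  induction k with
  | zero =>
    intro σ
    funext f
    obtain ⟨c, rfl⟩ : ∃ c, f = fun _ => c :=
      ⟨f 0, by funext i; congr 1; exact Fin.ext (by simp)⟩
    cases σ <;> cases c <;> simp [St, S, Dloc, hq, neg_div]
  | succ k ih =>
    intro σ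
    funext f
    cases σ <;> cases hc : f (Fin.last (k + 1)) <;>
      simp [St, S, Dloc, tensAppend, hq, ih, hc, neg_div, Fin.prod_univ_castSucc (n := k + 1)] <;>
      ring
end

section
/- For every σ > 0 and T > 0, the single-photon fidelity averaged over both the Gaussian Overhauser field (mean 0, standard deviation σ) and the timing offset t uniformly distributed on [−T, T] is F̄^(1) = (1/(2T)) ∫_{−T}^{T} ∫_ℝ cos²(b t / 2) · (1/(σ√(2π))) e^{−b²/(2σ²)} db dt = 1/2 + (1/(√2 · T σ)) ∫_0^{Tσ/√2} e^{−u²} du; equivalently, F̄^(1) = 1/2 + (√(2π)/(4 T σ)) · erf(Tσ/√2), where erf(x) = (2/√π) ∫_0^x e^{−u²} du. -/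
open MeasureTheory Real

/-- The error function `erf(x) = (2/√π) ∫_0^x e^{−u²} du`. -/
noncomputable def erf (x : ℝ) : ℝ :=
  (2 / Real.sqrt Real.pi) * ∫ u in (0 : ℝ)..x, Real.exp (-u ^ 2)

/-- The Gaussian density of the Overhauser field as a Mathlib Gaussian measure. -/
lemma cos_gauss (σ t : ℝ) (hσ : 0 < σ) :
    ∫ b : ℝ, Real.cos (b * t / 2) ^ 2 *
      ((1 / (σ * Real.sqrt (2 * Real.pi))) * Real.exp (-(b ^ 2) / (2 * σ ^ 2))) =
    1 / 2 + 1 / 2 * Real.exp (-(t * (σ / Real.sqrt 2)) ^ 2) := by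
  set v : NNReal := ⟨σ ^ 2, by positivity⟩ with hv
  have hv' : (v : ℝ) = σ ^ 2 := rfl
  have hv0 : v ≠ 0 := by
    intro h
    have : (v : ℝ) = 0 := by rw [h]; rfl
    rw [hv'] at this
    exact (pow_pos hσ 2).ne' this
  let μ := ProbabilityTheory.gaussianReal 0 v
  have h1 : ∫ b : ℝ, Real.cos (b * t / 2) ^ 2 *
      ((1 / (σ * Real.sqrt (2 * Real.pi))) * Real.exp (-(b ^ 2) / (2 * σ ^ 2))) =
      ∫ b, Real.cos (b * t / 2) ^ 2 ∂μ := by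
    rw [ProbabilityTheory.integral_gaussianReal_eq_integral_smul hv0]
    congr 1
    ext b
    rw [ProbabilityTheory.gaussianPDFReal, hv', smul_eq_mul, mul_comm (2 * Real.pi),
      Real.sqrt_mul (by positivity : (0 : ℝ) ≤ σ ^ 2), Real.sqrt_sq hσ.le]
    simp only [one_div, sub_zero]
    ring
  have hint : Integrable (fun b : ℝ => Complex.exp (t * b * Complex.I)) μ := by
    refine Integrable.of_bound (C := 1) (by fun_prop) (Filter.Eventually.of_forall fun b => ?_)
    have := Complex.norm_exp_ofReal_mul_I (t * b)
    push_cast at this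
    exact this.le
  have hre : ∀ b : ℝ, RCLike.re (Complex.exp (t * b * Complex.I)) = Real.cos (t * b) := by
    intro b
    have := Complex.exp_ofReal_mul_I_re (t * b)
    push_cast at this
    exact this
  have hcosint : Integrable (fun b : ℝ => Real.cos (t * b)) μ := by
    have := hint.re
    simpa only [hre] using this
  have hcos : ∫ b, Real.cos (t * b) ∂μ = Real.exp (-(t * (σ / Real.sqrt 2)) ^ 2) := by
    have h2 := ProbabilityTheory.charFun_gaussianReal (μ := 0) (v := v) t
    rw [charFun_apply_real] at h2
    have h3 := integral_re hint
    simp only [hre] at h3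
    rw [h3, h2, hv']
    have : ((t : ℂ) * (0 : ℝ) * Complex.I - ((σ ^ 2 : ℝ) : ℂ) * t ^ 2 / 2) =
        ((-(t * (σ / Real.sqrt 2)) ^ 2 : ℝ) : ℂ) := by
      have : -(t * (σ / Real.sqrt 2)) ^ 2 = - (σ ^ 2 * t ^ 2 / 2) := by
        rw [mul_pow, div_pow, Real.sq_sqrt (by norm_num)]; ring
      rw [this]; push_cast; ring
    rw [this]
    exact Complex.exp_ofReal_re _
  rw [h1, ← hcos]
  have h4 : ∀ b : ℝ, Real.cos (b * t / 2) ^ 2 = 1 / 2 + 1 / 2 * Real.cos (t * b) := by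
    intro b
    rw [Real.cos_sq, show 2 * (b * t / 2) = t * b by ring]; ring
  simp only [h4]
  rw [integral_add (integrable_const _) (hcosint.const_mul _), integral_const_mul]
  simp [μ]

/-- The single-photon fidelity averaged over both the Gaussian Overhauser field
(mean `0`, standard deviation `σ`) and the timing offset `t` uniform on `[−T, T]`:
`F̄^(1) = (1/(2T)) ∫_{−T}^{T} ∫_ℝ cos²(bt/2) (1/(σ√(2π))) e^{−b²/(2σ²)} db dt
       = 1/2 + (1/(√2·Tσ)) ∫_0^{Tσ/√2} e^{−u²} du`,
equivalently `F̄^(1) = 1/2 + (√(2π)/(4Tσ)) erf(Tσ/√2)`. -/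
theorem doubly_averaged_fidelity (σ T : ℝ) (hσ : 0 < σ) (hT : 0 < T) :
    ((1 / (2 * T)) *
        ∫ t in (-T)..T,
          ∫ b : ℝ,
            Real.cos (b * t / 2) ^ 2 *
              ((1 / (σ * Real.sqrt (2 * Real.pi))) * Real.exp (-(b ^ 2) / (2 * σ ^ 2)))) =
        1 / 2 +
          (1 / (Real.sqrt 2 * T * σ)) *
            ∫ u in (0 : ℝ)..(T * σ / Real.sqrt 2), Real.exp (-u ^ 2) ∧
      ((1 / (2 * T)) *
          ∫ t in (-T)..T,
            ∫ b : ℝ,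
              Real.cos (b * t / 2) ^ 2 *
                ((1 / (σ * Real.sqrt (2 * Real.pi))) * Real.exp (-(b ^ 2) / (2 * σ ^ 2)))) =
        1 / 2 + (Real.sqrt (2 * Real.pi) / (4 * T * σ)) * erf (T * σ / Real.sqrt 2) := by
  have key : ((1 / (2 * T)) *
        ∫ t in (-T)..T,
          ∫ b : ℝ,
            Real.cos (b * t / 2) ^ 2 *
              ((1 / (σ * Real.sqrt (2 * Real.pi))) * Real.exp (-(b ^ 2) / (2 * σ ^ 2)))) =
        1 / 2 +
          (1 / (Real.sqrt 2 * T * σ)) *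
            ∫ u in (0 : ℝ)..(T * σ / Real.sqrt 2), Real.exp (-u ^ 2) := by
    have h2 : (0 : ℝ) < Real.sqrt 2 := by positivity
    have hs : Real.sqrt 2 ^ 2 = 2 := Real.sq_sqrt (by norm_num)
    have hc : σ / Real.sqrt 2 ≠ 0 := by positivity
    simp only [cos_gauss σ _ hσ]
    have hI : ∀ a b : ℝ, IntervalIntegrable (fun u : ℝ => Real.exp (-u ^ 2)) volume a b :=
      fun a b => (by fun_prop : Continuous fun u : ℝ => Real.exp (-u ^ 2)).intervalIntegrable a b
    rw [intervalIntegral.integral_add (by simp)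
      ((by fun_prop : Continuous fun t : ℝ =>
        1 / 2 * Real.exp (-(t * (σ / Real.sqrt 2)) ^ 2)).intervalIntegrable _ _),
      intervalIntegral.integral_const_mul,
      intervalIntegral.integral_comp_mul_right (fun u => Real.exp (-u ^ 2)) hc,
      ← intervalIntegral.integral_add_adjacent_intervals (hI _ 0) (hI 0 _)]
    have he := intervalIntegral.integral_comp_neg (a := 0) (b := T * (σ / Real.sqrt 2))
      (fun u => Real.exp (-u ^ 2))
    simp only [neg_sq, neg_zero] at he
    rw [neg_mul, ← he, mul_div_assoc]
    generalize (∫ u in (0 : ℝ)..(T * (σ / Real.sqrt 2)), Real.exp (-u ^ 2)) = J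
    simp only [intervalIntegral.integral_const, smul_eq_mul]
    field_simp
    linear_combination (2 * J) * hs
  refine ⟨key, key.trans ?_⟩
  rw [erf, Real.sqrt_mul (by norm_num)]
  have h2 : (0 : ℝ) < Real.sqrt 2 := by positivity
  have hs : Real.sqrt 2 ^ 2 = 2 := Real.sq_sqrt (by norm_num)
  have hp : (0 : ℝ) < Real.sqrt Real.pi := Real.sqrt_pos.mpr Real.pi_pos
  generalize (∫ u in (0 : ℝ)..(T * σ / Real.sqrt 2), Real.exp (-u ^ 2)) = J
  field_simp
  linear_combination (-4 * J) * hs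
end
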